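/- arXiv:1011.3407 — 3 statements merged into one kernel-verified Lean document; each statement's English description precedes it below -/
import Mathlib

section
/- Soundness of the static semantics at the statement level: if the Hoare-style judgement {p} s {q} is derivable in Pest's static semantics, then for every state σ with σ ⊨ p there exists a state σ' such that ⟨σ, s⟩ ⇓ σ' in the big-step operational semantics (so in particular execution does not get stuck on any annotation and terminates) and σ' ⊨ q. -/
namespace Pest

/-- Program variables. -/
abbrev Var := String

/-- Values. -/
abbrev Val := Int

/-- States map variables to values. -/
abbrev State := Var → Val

/-- State update `σ[v ↦ n]`. -/
def State.upd (σ : State) (v : Var) (n : Val) : State :=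
  fun w => if w = v then n else σ w

/-- Expressions: a partial evaluation `⟦e⟧σ` together with a safety predicate
    `safe(e)` such that `σ ⊨ safe(e)` implies `⟦e⟧σ` is defined. -/
structure Expr (α : Type) where
  eval : State → Option α
  safe : State → Prop
  safe_eval : ∀ σ : State, safe σ → (eval σ).isSome

abbrev IExpr := Expr Val
abbrev BExpr := Expr Bool

/-- Predicates on states; `σ ⊨ p` is `p σ`. -/
abbrev Pred := State → Prop

/-- Semantic entailment `p ⊨ q`: every state satisfying `p` satisfies `q`. -/
def Entails (p q : Pred) : Prop := ∀ σ : State, p σ → q σ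

/-- Pest statements.  A while-loop `while g :?! inv :# var do s od` carries an
    invariant annotation `inv` and an integer variant annotation `var`. -/
inductive Stmt where
  | skip : Stmt
  | assign : Var → IExpr → Stmt
  | seq : Stmt → Stmt → Stmt
  | ite : BExpr → Stmt → Stmt → Stmt
  | whileLoop : BExpr → BExpr → IExpr → Stmt → Stmt   -- guard, invariant, variant, body

/-- Big-step operational semantics `⟨σ, s⟩ ⇓ σ'`.  Annotations act as
    assertions: the invariant must evaluate to true before each evaluation of
    the guard, and when the guard is true the variant must be strictly
    positive before the body and strictly smaller after it; otherwise the
    computation gets stuck (no derivation exists). -/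
inductive BigStep : State → Stmt → State → Prop where
  | skip (σ : State) : BigStep σ .skip σ
  | assign {σ : State} {v : Var} {e : IExpr} {n : Val} :
      e.eval σ = some n → BigStep σ (.assign v e) (σ.upd v n)
  | seq {σ σ' σ'' : State} {s₁ s₂ : Stmt} :
      BigStep σ s₁ σ' → BigStep σ' s₂ σ'' → BigStep σ (.seq s₁ s₂) σ''
  | iteTrue {σ σ' : State} {g : BExpr} {s₁ s₂ : Stmt} :
      g.eval σ = some true → BigStep σ s₁ σ' → BigStep σ (.ite g s₁ s₂) σ'
  | iteFalse {σ σ' : State} {g : BExpr} {s₁ s₂ : Stmt} :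
      g.eval σ = some false → BigStep σ s₂ σ' → BigStep σ (.ite g s₁ s₂) σ'
  | whileFalse {σ : State} {g inv : BExpr} {vr : IExpr} {s : Stmt} :
      inv.eval σ = some true → g.eval σ = some false →
      BigStep σ (.whileLoop g inv vr s) σ
  | whileTrue {σ σ' σ'' : State} {g inv : BExpr} {vr : IExpr} {s : Stmt} {n n' : Val} :
      inv.eval σ = some true → g.eval σ = some true →
      vr.eval σ = some n → 0 < n →
      BigStep σ s σ' →
      vr.eval σ' = some n' → n' < n →
      BigStep σ' (.whileLoop g inv vr s) σ'' →
      BigStep σ (.whileLoop g inv vr s) σ''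

/-- Hoare-style static semantics `{p} s {q}`.  The rules are the semantic
    renderings of S-SKIP, S-ASSIGN, S-SEQ, S-IF and S-WHILE; in S-WHILE the
    ghost variable `var₀` recording the entry value of the variant is rendered
    by indexing the intermediate predicates `p'`, `q'` by that value `n`. -/
inductive Hoare : Pred → Stmt → Pred → Prop where
  | skip {p q : Pred} : Entails p q → Hoare p .skip q
  | assign {p q : Pred} {v : Var} {e : IExpr} :
      Entails p e.safe →
      Entails (fun σ => ∃ n : Val, p (σ.upd v n) ∧ e.eval (σ.upd v n) = some (σ v)) q →
      Hoare p (.assign v e) q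
  | seq {p r q : Pred} {s₁ s₂ : Stmt} :
      Hoare p s₁ r → Hoare r s₂ q → Hoare p (.seq s₁ s₂) q
  | ite {p p₁ q₁ p₂ q₂ q : Pred} {g : BExpr} {s₁ s₂ : Stmt} :
      Entails p g.safe →
      Entails (fun σ => p σ ∧ g.eval σ = some true) p₁ →
      Hoare p₁ s₁ q₁ → Entails q₁ q →
      Entails (fun σ => p σ ∧ g.eval σ = some false) p₂ →
      Hoare p₂ s₂ q₂ → Entails q₂ q →
      Hoare p (.ite g s₁ s₂) q
  | whileLoop {p q : Pred} {g inv : BExpr} {vr : IExpr} {s : Stmt}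
      (p' q' : Val → Pred) :
      (∀ σ : State, inv.safe σ) →
      Entails (fun σ => inv.eval σ = some true) vr.safe →
      Entails (fun σ => inv.eval σ = some true) g.safe →
      Entails p (fun σ => inv.eval σ = some true) →
      (∀ n : Val, Entails
        (fun σ => inv.eval σ = some true ∧ g.eval σ = some true ∧ vr.eval σ = some n)
        (p' n)) →
      (∀ n : Val, Entails (p' n) (fun σ => ∃ m : Val, vr.eval σ = some m ∧ 0 < m)) →
      (∀ n : Val, Hoare (p' n) s (q' n)) →
      (∀ n : Val, Entails (q' n) (fun σ => inv.eval σ = some true)) →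
      (∀ n : Val, Entails (q' n) (fun σ => ∃ m : Val, vr.eval σ = some m ∧ m < n)) →
      Entails (fun σ => inv.eval σ = some true ∧ g.eval σ = some false) q →
      Hoare p (.whileLoop g inv vr s) q

theorem State.upd_upd_self (σ : State) (v : Var) (n : Val) :
    (σ.upd v n).upd v (σ v) = σ := by
  funext w
  by_cases hw : w = v <;> simp [State.upd, hw]

/-- Total correctness of a loop whose body, from any invariant state satisfying the guard,
    restores the invariant and decreases the positive variant. -/
theorem BigStep.exists_whileLoop {g inv : BExpr} {vr : IExpr} {s : Stmt}
    (hvr : Entails (fun σ => inv.eval σ = some true) vr.safe)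
    (hg : Entails (fun σ => inv.eval σ = some true) g.safe)
    (hbody : ∀ (σ : State) (n : Val), inv.eval σ = some true → g.eval σ = some true →
      vr.eval σ = some n → 0 < n ∧ ∃ σ' : State, BigStep σ s σ' ∧ inv.eval σ' = some true ∧
        ∃ n' : Val, vr.eval σ' = some n' ∧ n' < n)
    (σ : State) (hσ : inv.eval σ = some true) :
    ∃ σ' : State, BigStep σ (.whileLoop g inv vr s) σ' ∧
      inv.eval σ' = some true ∧ g.eval σ' = some false := by
  obtain ⟨n, hn⟩ := Option.isSome_iff_exists.mp (vr.safe_eval σ (hvr σ hσ))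
  induction hk : n.toNat using Nat.strong_induction_on generalizing σ n with
  | _ k ih =>
    obtain ⟨b, hb⟩ := Option.isSome_iff_exists.mp (g.safe_eval σ (hg σ hσ))
    cases b with
    | false => exact ⟨σ, .whileFalse hσ hb, hσ, hb⟩
    | true =>
      obtain ⟨hpos, σ₁, hs, hσ₁, n₁, hn₁, hlt⟩ := hbody σ n hσ hb hn
      obtain ⟨σ₂, hw, hσ₂⟩ := ih n₁.toNat (hk ▸ (Int.toNat_lt_toNat hpos).mpr hlt) σ₁ hσ₁ n₁ hn₁ rfl
      exact ⟨σ₂, .whileTrue hσ hb hn hpos hs hn₁ hlt hw, hσ₂⟩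

/-- Soundness of the static semantics at the statement level: if `{p} s {q}`
    is derivable, then from every state satisfying `p` the execution of `s`
    does not get stuck, terminates, and ends in a state satisfying `q`. -/
theorem static_semantics_sound {p q : Pred} {s : Stmt} (h : Hoare p s q) :
    ∀ σ : State, p σ → ∃ σ' : State, BigStep σ s σ' ∧ q σ' := by
  induction h with
  | skip hpq => exact fun σ hσ => ⟨σ, .skip σ, hpq σ hσ⟩
  | @assign p q v e hsafe hq =>
    intro σ hσ
    obtain ⟨n, hn⟩ := Option.isSome_iff_exists.mp (e.safe_eval σ (hsafe σ hσ))
    refine ⟨σ.upd v n, .assign hn, hq _ ⟨σ v, ?_⟩⟩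
    rw [State.upd_upd_self]
    exact ⟨hσ, by simpa [State.upd] using hn⟩
  | seq _ _ ih₁ ih₂ =>
    intro σ hσ
    obtain ⟨σ₁, h₁, hr⟩ := ih₁ σ hσ
    obtain ⟨σ₂, h₂, hq⟩ := ih₂ σ₁ hr
    exact ⟨σ₂, .seq h₁ h₂, hq⟩
  | @ite p p₁ q₁ p₂ q₂ q g s₁ s₂ hsafe hp₁ _ hq₁ hp₂ _ hq₂ ih₁ ih₂ =>
    intro σ hσ
    obtain ⟨b, hb⟩ := Option.isSome_iff_exists.mp (g.safe_eval σ (hsafe σ hσ))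
    cases b with
    | true =>
      obtain ⟨σ', h, hq⟩ := ih₁ σ (hp₁ σ ⟨hσ, hb⟩)
      exact ⟨σ', .iteTrue hb h, hq₁ σ' hq⟩
    | false =>
      obtain ⟨σ', h, hq⟩ := ih₂ σ (hp₂ σ ⟨hσ, hb⟩)
      exact ⟨σ', .iteFalse hb h, hq₂ σ' hq⟩
  | whileLoop p' q' _ hvr hg hp hp' hpos _ hinv hdec hq ih =>
    intro σ hσ
    obtain ⟨σ', hw, hσ'⟩ := BigStep.exists_whileLoop hvr hg (fun σ n hi ht hn => by
      have hpn := hp' n σ ⟨hi, ht, hn⟩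
      obtain ⟨m, hm, hm_pos⟩ := hpos n σ hpn
      obtain rfl : n = m := Option.some.inj (hn.symm.trans hm)
      obtain ⟨σ', hs, hqn⟩ := ih n σ hpn
      exact ⟨hm_pos, σ', hs, hinv n σ' hqn, hdec n σ' hqn⟩) σ (hp σ hσ)
    exact ⟨σ', hw, hq σ' hσ'⟩

end Pest
end

section
/- Soundness and termination of the annotated while-loop (the S-WHILE case of the soundness theorem): suppose the predicates p, inv, g, q and the integer expression var satisfy: inv is always safe to evaluate, inv ⊨ safe(var), inv ⊨ safe(g), p ⊨ inv, inv ∧ g ⊨ var > 0, every execution of the loop body s from a state satisfying inv ∧ g terminates in a state that satisfies inv and in which the value of var is strictly smaller than its value before the body, and inv ∧ ¬g ⊨ q. Then for every state σ with σ ⊨ p, the execution of while g :?! inv :# var do s od from σ terminates: there exists σ' with ⟨σ, while g :?! inv :# var do s od⟩ ⇓ σ' and σ' ⊨ q. -/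
namespace Pest

/-- Soundness and termination of the annotated while-loop (the S-WHILE case of
    the soundness theorem).  `inv` and `g` are boolean expressions evaluated by
    the operational semantics; `σ ⊨ inv` means `inv` evaluates to `true` in `σ`.
    Under the stated side conditions, from every state satisfying `p` the loop
    `while g :?! inv :# var do s od` terminates in a state satisfying `q`. -/
theorem while_loop_sound
    {p q : Pred} {g inv : BExpr} {vr : IExpr} {s : Stmt}
    -- inv is always safe to evaluate
    (hinv_safe : ∀ σ : State, inv.safe σ)
    -- inv ⊨ safe(var)
    (hvar_safe : ∀ σ : State, inv.eval σ = some true → vr.safe σ)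
    -- inv ⊨ safe(g)
    (hg_safe : ∀ σ : State, inv.eval σ = some true → g.safe σ)
    -- p ⊨ inv
    (hp_inv : ∀ σ : State, p σ → inv.eval σ = some true)
    -- inv ∧ g ⊨ var > 0
    (hvar_pos : ∀ σ : State, inv.eval σ = some true → g.eval σ = some true →
      ∃ n : Val, vr.eval σ = some n ∧ 0 < n)
    -- every execution of the body from a state satisfying inv ∧ g terminates ...
    (hbody_total : ∀ σ : State, inv.eval σ = some true → g.eval σ = some true →
      ∃ σ' : State, BigStep σ s σ')
    -- ... in a state satisfying inv in which the value of var is strictly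
    -- smaller than its value before the body
    (hbody : ∀ σ σ' : State, inv.eval σ = some true → g.eval σ = some true →
      BigStep σ s σ' →
      inv.eval σ' = some true ∧
        ∀ n n' : Val, vr.eval σ = some n → vr.eval σ' = some n' → n' < n)
    -- inv ∧ ¬g ⊨ q
    (hq : ∀ σ : State, inv.eval σ = some true → g.eval σ = some false → q σ) :
    ∀ σ : State, p σ →
      ∃ σ' : State, BigStep σ (.whileLoop g inv vr s) σ' ∧ q σ' := by
  have terminates : ∀ (k : ℕ) (σ : State) (n : Val), inv.eval σ = some true →
      vr.eval σ = some n → n.toNat = k →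
      ∃ σ' : State, BigStep σ (.whileLoop g inv vr s) σ' ∧ q σ' := by
    intro k
    induction k using Nat.strong_induction_on with
    | _ k ih =>
      intro σ n hinv hn hk
      obtain ⟨b, hb⟩ := Option.isSome_iff_exists.mp (g.safe_eval σ (hg_safe σ hinv))
      cases b with
      | false => exact ⟨σ, .whileFalse hinv hb, hq σ hinv hb⟩
      | true =>
        obtain ⟨m, hm, hpos⟩ := hvar_pos σ hinv hb
        obtain rfl : n = m := Option.some.inj (hn.symm.trans hm)
        obtain ⟨τ, hτ⟩ := hbody_total σ hinv hb
        obtain ⟨hinv', hdec⟩ := hbody σ τ hinv hb hτ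
        obtain ⟨n', hn'⟩ := Option.isSome_iff_exists.mp (vr.safe_eval τ (hvar_safe τ hinv'))
        have hlt : n' < n := hdec n n' hn hn'
        obtain ⟨σ', hloop, hqσ'⟩ := ih n'.toNat (hk ▸ (Int.toNat_lt_toNat hpos).mpr hlt) τ n' hinv' hn' rfl
        exact ⟨σ', .whileTrue hinv hb hn hpos hτ hn' hlt hloop, hqσ'⟩
  intro σ hp
  have hinv := hp_inv σ hp
  obtain ⟨n, hn⟩ := Option.isSome_iff_exists.mp (vr.safe_eval σ (hvar_safe σ hinv))
  exact terminates n.toNat σ n hinv hn rfl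

end Pest
end

section
/- Soundness of the precondition inference calculus: if the inferred precondition pre(s, q) is defined by the weakest-precondition-style calculus (using the provided invariant for while-loops), then the Hoare triple {pre(s, q)} s {q} is sound: for every state σ with σ ⊨ pre(s, q) there exists σ' with ⟨σ, s⟩ ⇓ σ' and σ' ⊨ q. -/
namespace Pest

/-- The weakest-precondition-style inference calculus: `PreCalc s q p` means
    that `pre(s, q)` is defined (all side conditions hold) and equals `p`.
    For assignments, `pre(v := e, q) = safe(e) ∧ q[v ↦ e]`; for sequences and
    conditionals it is computed structurally; for an annotated while-loop the
    inferred precondition is the provided invariant, subject to the side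
    conditions that the invariant is safe, makes the guard and variant safe,
    `inv ∧ g ⊨ var > 0`, the body re-establishes `inv` and strictly decreases
    `var` (computed through the calculus itself, with the entry value of the
    variant rendered by the index `n`), and `inv ∧ ¬g ⊨ q`. -/
inductive PreCalc : Stmt → Pred → Pred → Prop where
  | skip {q : Pred} : PreCalc .skip q q
  | assign {q : Pred} {v : Var} {e : IExpr} :
      PreCalc (.assign v e) q
        (fun σ => e.safe σ ∧ ∃ n : Val, e.eval σ = some n ∧ q (σ.upd v n))
  | seq {q r p : Pred} {s₁ s₂ : Stmt} :
      PreCalc s₂ q r → PreCalc s₁ r p → PreCalc (.seq s₁ s₂) q p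
  | ite {q p₁ p₂ : Pred} {g : BExpr} {s₁ s₂ : Stmt} :
      PreCalc s₁ q p₁ → PreCalc s₂ q p₂ →
      PreCalc (.ite g s₁ s₂) q
        (fun σ => g.safe σ ∧ (g.eval σ = some true → p₁ σ) ∧
                  (g.eval σ = some false → p₂ σ))
  | whileLoop {q : Pred} {g inv : BExpr} {vr : IExpr} {s : Stmt}
      (p' : Val → Pred) :
      (∀ σ : State, inv.safe σ) →
      Entails (fun σ => inv.eval σ = some true) vr.safe →
      Entails (fun σ => inv.eval σ = some true) g.safe →
      -- inv ∧ g ⊨ var > 0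
      Entails (fun σ => inv.eval σ = some true ∧ g.eval σ = some true)
              (fun σ => ∃ n : Val, vr.eval σ = some n ∧ 0 < n) →
      -- the body re-establishes inv and strictly decreases var
      (∀ n : Val, PreCalc s
        (fun σ => inv.eval σ = some true ∧ ∃ m : Val, vr.eval σ = some m ∧ m < n)
        (p' n)) →
      (∀ n : Val, Entails
        (fun σ => inv.eval σ = some true ∧ g.eval σ = some true ∧ vr.eval σ = some n)
        (p' n)) →
      -- inv ∧ ¬g ⊨ q
      Entails (fun σ => inv.eval σ = some true ∧ g.eval σ = some false) q →
      PreCalc (.whileLoop g inv vr s) q (fun σ => inv.eval σ = some true)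

/-- Soundness of the precondition inference calculus: whenever `pre(s, q)` is
    defined, the triple `{pre(s, q)} s {q}` is sound: from every state
    satisfying `pre(s, q)`, `s` executes normally and terminates in a state
    satisfying `q`. -/
theorem precalc_sound {s : Stmt} {q p : Pred} (h : PreCalc s q p) :
    ∀ σ : State, p σ → ∃ σ' : State, BigStep σ s σ' ∧ q σ' := by
  induction h with
  | skip => exact fun σ hq => ⟨σ, .skip σ, hq⟩
  | assign =>
    rintro σ ⟨-, n, hn, hq⟩
    exact ⟨_, .assign hn, hq⟩
  | seq _ _ ih₂ ih₁ =>
    intro σ hp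
    obtain ⟨σ', h₁, hr⟩ := ih₁ σ hp
    obtain ⟨σ'', h₂, hq⟩ := ih₂ σ' hr
    exact ⟨σ'', .seq h₁ h₂, hq⟩
  | @ite _ _ _ g _ _ _ _ ih₁ ih₂ =>
    rintro σ ⟨hs, ht, hf⟩
    obtain ⟨b, hb⟩ := Option.isSome_iff_exists.mp (g.safe_eval σ hs)
    cases b with
    | true =>
      obtain ⟨σ', h₁, hq⟩ := ih₁ σ (ht hb)
      exact ⟨σ', .iteTrue hb h₁, hq⟩
    | false =>
      obtain ⟨σ', h₂, hq⟩ := ih₂ σ (hf hb)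
      exact ⟨σ', .iteFalse hb h₂, hq⟩
  | @whileLoop _ g inv vr _ _ _ _ hg hpos _ hbody hexit ih =>
    intro σ
    induction hk : ((vr.eval σ).getD 0).toNat using Nat.strong_induction_on generalizing σ with
    | _ k ihk =>
      intro hinv
      obtain ⟨b, hb⟩ := Option.isSome_iff_exists.mp (g.safe_eval σ (hg σ hinv))
      cases b with
      | false => exact ⟨σ, .whileFalse hinv hb, hexit σ ⟨hinv, hb⟩⟩
      | true =>
        obtain ⟨n, hn, hn0⟩ := hpos σ ⟨hinv, hb⟩
        obtain ⟨σ', hs, hinv', m, hm, hmn⟩ := ih n σ (hbody n σ ⟨hinv, hb, hn⟩)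
        have hlt : ((vr.eval σ').getD 0).toNat < k := by
          rw [← hk, hn, hm]
          exact (Int.toNat_lt_toNat hn0).mpr hmn
        obtain ⟨σ'', hw, hq⟩ := ihk _ hlt σ' rfl hinv'
        exact ⟨σ'', .whileTrue hinv hb hn hn0 hs hm hmn hw, hq⟩

end Pest
end
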